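/- The real 4×4 matrix with rows (−1.99, −0.99, −0.99, −0.99), (97.02, −2.98, −1.98, −1.98), (96.03, 96.03, −3.97, −2.97), (−99, −99, −99, −199) has a complex eigenvalue with strictly positive real part. -/

import Mathlib

open Polynomial Matrix

/-- `z : ℂ` is an eigenvalue of the real matrix `A` if it is a root of the
characteristic polynomial of `A`, regarded as a polynomial over `ℂ`. -/
def IsEigenvalue {n : ℕ} (A : Matrix (Fin n) (Fin n) ℝ) (z : ℂ) : Prop :=
  ((A.charpoly).map (algebraMap ℝ ℂ)).IsRoot z

/-- A real monic quartic with two distinct real roots whose sum is less than the sum of all four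
roots has a complex root with positive real part. -/
theorem exists_quartic_root_re_pos {a b c d r s : ℝ} (hrs : r ≠ s)
    (hr : r ^ 4 + a * r ^ 3 + b * r ^ 2 + c * r + d = 0)
    (hs : s ^ 4 + a * s ^ 3 + b * s ^ 2 + c * s + d = 0) (hsum : a + r + s < 0) :
    ∃ z : ℂ, z ^ 4 + a * z ^ 3 + b * z ^ 2 + c * z + d = 0 ∧ 0 < z.re := by
  -- The other two roots are those of `z ^ 2 + p * z + q`.
  set p : ℝ := a + r + s with hp
  set q : ℝ := b + a * (r + s) + (r ^ 2 + r * s + s ^ 2) with hq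
  obtain ⟨w, hw, hwre⟩ : ∃ w : ℂ, w ^ 2 = (p : ℂ) ^ 2 / 4 - q ∧ 0 ≤ w.re := by
    obtain ⟨w, hw⟩ := IsAlgClosed.exists_pow_nat_eq ((p : ℂ) ^ 2 / 4 - q) two_pos
    rcases le_total 0 w.re with h | h
    · exact ⟨w, hw, h⟩
    · exact ⟨-w, by rw [neg_sq, hw], by simpa using h⟩
  refine ⟨((-p / 2 : ℝ) : ℂ) + w, ?_, ?_⟩
  · have hquad : (((-p / 2 : ℝ) : ℂ) + w) ^ 2 + p * (((-p / 2 : ℝ) : ℂ) + w) + q = 0 := by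
      push_cast
      linear_combination hw
    generalize ((-p / 2 : ℝ) : ℂ) + w = z at hquad
    have hr' : (r : ℂ) ^ 4 + a * r ^ 3 + b * r ^ 2 + c * r + d = 0 := by exact_mod_cast hr
    have hs' : (s : ℂ) ^ 4 + a * s ^ 3 + b * s ^ 2 + c * s + d = 0 := by exact_mod_cast hs
    have hne : (r : ℂ) - s ≠ 0 := sub_ne_zero.mpr (by exact_mod_cast hrs)
    refine (mul_eq_zero.mp ?_).resolve_left hne
    rw [hp, hq] at hquad
    push_cast at hquad
    linear_combination (z - s) * hr' - (z - r) * hs' + (r - s) * (z - r) * (z - s) * hquad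
  · rw [Complex.add_re, Complex.ofReal_re]
    linarith

theorem stmt11 :
    ∃ z : ℂ,
      IsEigenvalue
        !![(-1.99 : ℝ), -0.99, -0.99, -0.99;
           97.02, -2.98, -1.98, -1.98;
           96.03, 96.03, -3.97, -2.97;
           -99, -99, -99, -199] z ∧ 0 < z.re := by
  let f : ℝ → ℝ := fun x ↦ x ^ 4 + 207.94 * x ^ 3 + 1597.92 * x ^ 2 + 51090.97 * x + 1010296
  have hf : Continuous f := by fun_prop
  obtain ⟨r, hr, hfr⟩ : (0 : ℝ) ∈ f '' Set.Icc (-202) (-201) :=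
    intermediate_value_Icc' (by norm_num) hf.continuousOn (by norm_num [f])
  obtain ⟨s, hs, hfs⟩ : (0 : ℝ) ∈ f '' Set.Icc (-15) (-14) :=
    intermediate_value_Icc (by norm_num) hf.continuousOn (by norm_num [f])
  obtain ⟨z, hz, hzre⟩ := exists_quartic_root_re_pos (by linarith [hr.2, hs.1] : r < s).ne hfr hfs
    (by linarith [hr.2, hs.2])
  refine ⟨z, ?_, hzre⟩
  rw [IsEigenvalue, ← Matrix.charpoly_map, Polynomial.IsRoot, Matrix.eval_charpoly, ← hz]
  simp [Matrix.det_succ_row_zero, Fin.sum_univ_succ, Fin.succAbove, Matrix.scalar_apply,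
    Matrix.diagonal_apply]
  ring
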